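/- arXiv:2510.16122 — 2 statements merged into one kernel-verified Lean document; each statement's English description precedes it below -/
import Mathlib

section
/- (Two-way decomposition, lower bound.) Let P and Q be probability measures on a product X × Y of standard Borel spaces, with X-marginals P_X, Q_X and conditional distributions P_{Y|X=x}, Q_{Y|X=x} obtained by disintegration. Then | TV(P_X, Q_X) − E_{x∼P_X}[ TV(P_{Y|X=x}, Q_{Y|X=x}) ] | ≤ TV(P, Q), where TV(P, Q) is the total variation distance between the joint distributions on X × Y. -/
open MeasureTheory
open scoped ENNReal

/-- Total variation distance between two measures:
`TV(P,Q) = sup_{A measurable} |P(A) − Q(A)|`. -/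
noncomputable def tv {Ω : Type*} [MeasurableSpace Ω] (P Q : Measure Ω) : ℝ :=
  ⨆ A : {A : Set Ω // MeasurableSet A}, |(P A.1).toReal - (Q A.1).toReal|

open ProbabilityTheory

lemma abs_sub_le_tv {Ω : Type*} [MeasurableSpace Ω] (P Q : Measure Ω)
    [IsProbabilityMeasure P] [IsProbabilityMeasure Q] {A : Set Ω} (hA : MeasurableSet A) :
    |P.real A - Q.real A| ≤ tv P Q := by
  refine le_ciSup (f := fun A : {A : Set Ω // MeasurableSet A} =>
    |(P A.1).toReal - (Q A.1).toReal|) ⟨1, ?_⟩ ⟨A, hA⟩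
  rintro _ ⟨B, rfl⟩
  exact abs_sub_le_of_nonneg_of_le measureReal_nonneg measureReal_le_one
    measureReal_nonneg measureReal_le_one

lemma tv_nonneg {Ω : Type*} [MeasurableSpace Ω] (P Q : Measure Ω) : 0 ≤ tv P Q :=
  Real.iSup_nonneg fun _ => abs_nonneg _

/-- A positive set of a Hahn decomposition maximizes the difference of the integrals among
all functions with values in `[0, 1]`. -/
lemma MeasureTheory.IsHahnDecomposition.integral_sub_integral_le {Ω : Type*}
    [MeasurableSpace Ω] {μ ν : Measure Ω} [IsFiniteMeasure μ] [IsFiniteMeasure ν] {s : Set Ω}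
    (hs : IsHahnDecomposition μ ν s) {h : Ω → ℝ} (hm : Measurable h)
    (h0 : ∀ x, 0 ≤ h x) (h1 : ∀ x, h x ≤ 1) :
    ∫ x, h x ∂ν - ∫ x, h x ∂μ ≤ ν.real s - μ.real s := by
  have hint (ρ : Measure Ω) [IsFiniteMeasure ρ] : Integrable h ρ :=
    Integrable.of_bound hm.aestronglyMeasurable 1 (ae_of_all _ fun x => by
      rw [Real.norm_of_nonneg (h0 x)]; exact h1 x)
  have h_compl : ∫ x in sᶜ, h x ∂ν ≤ ∫ x in sᶜ, h x ∂μ :=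
    integral_mono_measure hs.ge_on_compl (ae_of_all _ h0) (hint _)
  have h_on : ∫ x in s, (1 - h x) ∂μ ≤ ∫ x in s, (1 - h x) ∂ν :=
    integral_mono_measure hs.le_on (ae_of_all _ fun x => sub_nonneg.2 (h1 x))
      ((integrable_const 1).sub (hint _))
  rw [integral_sub (integrable_const _) (hint _), integral_sub (integrable_const _) (hint _)]
    at h_on
  simp only [integral_const, smul_eq_mul, mul_one, measureReal_restrict_apply_univ] at h_on
  rw [← integral_add_compl hs.measurableSet (hint ν),
    ← integral_add_compl hs.measurableSet (hint μ)]
  linarith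

lemma MeasureTheory.IsHahnDecomposition.tv_le {Ω : Type*} [MeasurableSpace Ω]
    {μ ν : Measure Ω} [IsProbabilityMeasure μ] [IsProbabilityMeasure ν] {s : Set Ω}
    (hs : IsHahnDecomposition μ ν s) : tv ν μ ≤ ν.real s - μ.real s := by
  have key {B : Set Ω} (hB : MeasurableSet B) :
      ν.real B - μ.real B ≤ ν.real s - μ.real s := by
    have := hs.integral_sub_integral_le (h := B.indicator 1)
      (measurable_one.indicator hB) (Set.indicator_nonneg fun _ _ => zero_le_one)
      (Set.indicator_le' (fun _ _ => le_rfl) fun _ _ => zero_le_one)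
    rwa [integral_indicator_one hB, integral_indicator_one hB] at this
  have : Nonempty {A : Set Ω // MeasurableSet A} := ⟨⟨∅, .empty⟩⟩
  refine ciSup_le fun B => abs_le.2 ⟨?_, key B.2⟩
  have := key B.2.compl
  rw [probReal_compl_eq_one_sub B.2, probReal_compl_eq_one_sub B.2] at this
  change _ ≤ ν.real B.1 - μ.real B.1
  linarith

lemma integral_sub_integral_le_tv {Ω : Type*} [MeasurableSpace Ω] (P Q : Measure Ω)
    [IsProbabilityMeasure P] [IsProbabilityMeasure Q] {h : Ω → ℝ} (hm : Measurable h)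
    (h0 : ∀ x, 0 ≤ h x) (h1 : ∀ x, h x ≤ 1) :
    ∫ x, h x ∂Q - ∫ x, h x ∂P ≤ tv P Q := by
  obtain ⟨s, hs⟩ := exists_isHahnDecomposition P Q
  refine (hs.integral_sub_integral_le hm h0 h1).trans ?_
  exact (neg_sub (P.real s) (Q.real s) ▸ neg_le_abs _).trans (abs_sub_le_tv P Q hs.measurableSet)

/-- Hahn decompositions of `κ a` and `η a` can be chosen jointly measurably in `a`. -/
lemma ProbabilityTheory.Kernel.exists_measurableSet_isHahnDecomposition {α γ : Type*}
    [MeasurableSpace α] [MeasurableSpace γ]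
    [MeasurableSpace.CountableOrCountablyGenerated α γ]
    (κ η : Kernel α γ) [IsFiniteKernel κ] [IsFiniteKernel η] :
    ∃ A : Set (α × γ), MeasurableSet A ∧
      ∀ a, IsHahnDecomposition (κ a) (η a) (Prod.mk a ⁻¹' A) := by
  have hf := Kernel.measurable_rnDeriv κ (κ + η)
  have hg := Kernel.measurable_rnDeriv η (κ + η)
  have hA := measurableSet_le hf hg
  refine ⟨_, hA, fun a => ?_⟩
  have hAa := (measurable_prodMk_left : Measurable (Prod.mk a : γ → α × γ)) hA
  have hκ : ((κ + η) a).withDensity (κ.rnDeriv (κ + η) a) = κ a := by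
    rw [← Kernel.withDensity_apply _ hf]
    exact Kernel.withDensity_rnDeriv_eq
      (Measure.absolutelyContinuous_of_le (Measure.le_add_right le_rfl))
  have hη : ((κ + η) a).withDensity (η.rnDeriv (κ + η) a) = η a := by
    rw [← Kernel.withDensity_apply _ hg]
    exact Kernel.withDensity_rnDeriv_eq
      (Measure.absolutelyContinuous_of_le (Measure.le_add_left le_rfl))
  refine ⟨hAa, ?_, ?_⟩
  · rw [← hκ, ← hη, restrict_withDensity hAa, restrict_withDensity hAa]
    exact withDensity_mono ((ae_restrict_mem hAa).mono fun _ hy => hy)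
  · rw [← hκ, ← hη, restrict_withDensity hAa.compl, restrict_withDensity hAa.compl]
    exact withDensity_mono ((ae_restrict_mem hAa.compl).mono fun _ hy => 
      (le_total _ _).resolve_left hy)

lemma integrable_kernel_prodMk_left {X Y : Type*} [MeasurableSpace X] [MeasurableSpace Y]
    (μ : Measure X) [IsFiniteMeasure μ] (κ : Kernel X Y) [IsMarkovKernel κ]
    {A : Set (X × Y)} (hA : MeasurableSet A) :
    Integrable (fun x => (κ x).real (Prod.mk x ⁻¹' A)) μ :=
  Integrable.of_bound (Kernel.measurable_kernel_prodMk_left hA).ennreal_toReal.aestronglyMeasurable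
    1 (ae_of_all _ fun _ => by
      rw [Real.norm_of_nonneg measureReal_nonneg]; exact measureReal_le_one)

lemma integral_condKernel_prodMk_left {X Y : Type*} [MeasurableSpace X] [MeasurableSpace Y]
    [StandardBorelSpace Y] [Nonempty Y] (P : Measure (X × Y)) [IsFiniteMeasure P]
    {A : Set (X × Y)} (hA : MeasurableSet A) :
    ∫ x, (P.condKernel x).real (Prod.mk x ⁻¹' A) ∂P.fst = P.real A := by
  simp only [measureReal_def]
  rw [integral_toReal (Kernel.measurable_kernel_prodMk_left hA).aemeasurable
    (ae_of_all _ fun _ => measure_lt_top _ _), ← Measure.compProd_apply hA,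
    P.disintegrate P.condKernel]

lemma tv_fst_le {X Y : Type*} [MeasurableSpace X] [MeasurableSpace Y]
    (P Q : Measure (X × Y)) [IsProbabilityMeasure P] [IsProbabilityMeasure Q] :
    tv P.fst Q.fst ≤ tv P Q := by
  have : Nonempty {A : Set X // MeasurableSet A} := ⟨⟨∅, .empty⟩⟩
  refine ciSup_le fun B => ?_
  rw [Measure.fst_apply B.2, Measure.fst_apply B.2]
  exact abs_sub_le_tv P Q (measurable_fst B.2)

lemma integral_tv_condKernel_le {X Y : Type*} [MeasurableSpace X]
    [MeasurableSpace Y] [StandardBorelSpace Y] [Nonempty Y]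
    (P Q : Measure (X × Y)) [IsProbabilityMeasure P] [IsProbabilityMeasure Q] :
    ∫ x, tv (P.condKernel x) (Q.condKernel x) ∂P.fst ≤ tv P Q + tv P.fst Q.fst := by
  obtain ⟨A, hA, hAx⟩ :=
    Kernel.exists_measurableSet_isHahnDecomposition Q.condKernel P.condKernel
  have hP := integrable_kernel_prodMk_left P.fst P.condKernel hA
  have hQ := integrable_kernel_prodMk_left P.fst Q.condKernel hA
  have h_le : ∫ x, tv (P.condKernel x) (Q.condKernel x) ∂P.fst ≤
      ∫ x, ((P.condKernel x).real (Prod.mk x ⁻¹' A) -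
        (Q.condKernel x).real (Prod.mk x ⁻¹' A)) ∂P.fst :=
    integral_mono_of_nonneg (ae_of_all _ fun _ => tv_nonneg _ _) (hP.sub hQ)
      (ae_of_all _ fun x => (hAx x).tv_le)
  rw [integral_sub hP hQ, integral_condKernel_prodMk_left P hA] at h_le
  have h_fst := integral_sub_integral_le_tv P.fst Q.fst
    (h := fun x => (Q.condKernel x).real (Prod.mk x ⁻¹' A))
    (Kernel.measurable_kernel_prodMk_left hA).ennreal_toReal
    (fun _ => measureReal_nonneg) (fun _ => measureReal_le_one)
  rw [integral_condKernel_prodMk_left Q hA] at h_fst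
  linarith [(le_abs_self _).trans (abs_sub_le_tv P Q hA)]

/-- Two-way decomposition, lower bound:
`|TV(P_X,Q_X) − E_{x∼P_X}[TV(P_{Y|X=x}, Q_{Y|X=x})]| ≤ TV(P,Q)` for probability measures
on a product of standard Borel spaces, with conditionals given by disintegration. -/
theorem abs_sub_le_tv_joint
    {X Y : Type*} [MeasurableSpace X] [StandardBorelSpace X]
    [MeasurableSpace Y] [StandardBorelSpace Y] [Nonempty Y]
    (P Q : Measure (X × Y)) [IsProbabilityMeasure P] [IsProbabilityMeasure Q] :
    |tv P.fst Q.fst - ∫ x, tv (P.condKernel x) (Q.condKernel x) ∂P.fst| ≤ tv P Q := by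
  have h_nonneg : 0 ≤ ∫ x, tv (P.condKernel x) (Q.condKernel x) ∂P.fst :=
    integral_nonneg fun _ => tv_nonneg _ _
  rw [abs_le]
  constructor
  · linarith [integral_tv_condKernel_le P Q]
  · linarith [tv_fst_le P Q]
end

section
/- (Chain rule for KL divergence of joint distributions.) Let P and Q be probability measures on a product X × Y of standard Borel spaces, with X-marginals P_X, Q_X and conditional distributions P_{Y|X=x}, Q_{Y|X=x} obtained by disintegration. Then KL(P ‖ Q) = KL(P_X ‖ Q_X) + E_{x∼P_X}[ KL(P_{Y|X=x} ‖ Q_{Y|X=x}) ], where KL(P ‖ Q) is the Kullback–Leibler divergence between the joint distributions on X × Y. -/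
open MeasureTheory
open scoped ENNReal Classical

/-- Kullback–Leibler divergence `KL(P‖Q) = ∫ log (dP/dQ) dP` when `P ≪ Q` (and the
log-likelihood ratio is integrable), and `+∞` otherwise. -/
noncomputable def kl {Ω : Type*} [MeasurableSpace Ω] (P Q : Measure Ω) : ℝ≥0∞ :=
  if P ≪ Q ∧ Integrable (llr P Q) P then ENNReal.ofReal (∫ ω, llr P Q ω ∂P) else ∞

theorem kl_eq_klDiv {Ω : Type*} [MeasurableSpace Ω] (P Q : Measure Ω)
    [IsProbabilityMeasure P] [IsProbabilityMeasure Q] :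
    kl P Q = InformationTheory.klDiv P Q := by
  by_cases h : P ≪ Q ∧ Integrable (llr P Q) P
  · rw [kl, if_pos h, InformationTheory.klDiv_of_ac_of_integrable h.1 h.2]
    simp
  · rw [kl, if_neg h, eq_comm, InformationTheory.klDiv_eq_top_iff]
    exact fun h1 h2 ↦ h ⟨h1, h2⟩

open ProbabilityTheory in
/-- The Radon–Nikodym derivative of composition-products with the same first measure is the
kernel Radon–Nikodym derivative. -/
theorem rnDeriv_compProd_right_eq_kernel_rnDeriv {X Y : Type*} [MeasurableSpace X]
    [MeasurableSpace Y] [MeasurableSpace.CountableOrCountablyGenerated X Y]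
    (μ : Measure X) (κ η : Kernel X Y) [IsFiniteMeasure μ] [IsFiniteKernel κ] [IsFiniteKernel η]
    (h : ∀ᵐ x ∂μ, κ x ≪ η x) :
    (μ ⊗ₘ κ).rnDeriv (μ ⊗ₘ η) =ᵐ[μ ⊗ₘ η] fun p ↦ κ.rnDeriv η p.1 p.2 := by
  have hκ : η.withDensity (κ.rnDeriv η) =ᵐ[μ] κ := by
    filter_upwards [h] with x hx using Kernel.withDensity_rnDeriv_eq hx
  rw [← Measure.compProd_congr hκ, Measure.compProd_withDensity (κ.measurable_rnDeriv η)]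
  exact Measure.rnDeriv_withDensity _ (κ.measurable_rnDeriv η)

open ProbabilityTheory InformationTheory in
/-- The divergence between composition-products with the same first measure is the average of
the divergences between the kernels. -/
theorem klDiv_compProd_right_eq_lintegral {X Y : Type*} [MeasurableSpace X]
    [MeasurableSpace Y] [MeasurableSpace.CountableOrCountablyGenerated X Y]
    (μ : Measure X) (κ η : Kernel X Y) [IsFiniteMeasure μ] [IsFiniteKernel κ] [IsFiniteKernel η] :
    klDiv (μ ⊗ₘ κ) (μ ⊗ₘ η) = ∫⁻ x, klDiv (κ x) (η x) ∂μ := by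
  by_cases h : ∀ᵐ x ∂μ, κ x ≪ η x
  · rw [klDiv_eq_lintegral_klFun_of_ac (Measure.absolutelyContinuous_compProd_right_iff.2 h)]
    have hm : Measurable fun p : X × Y ↦
        ENNReal.ofReal (klFun (κ.rnDeriv η p.1 p.2).toReal) :=
      (measurable_klFun.comp (κ.measurable_rnDeriv η).ennreal_toReal).ennreal_ofReal
    calc
      _ = ∫⁻ p, ENNReal.ofReal (klFun (κ.rnDeriv η p.1 p.2).toReal) ∂(μ ⊗ₘ η) := by
        refine lintegral_congr_ae ?_
        filter_upwards [rnDeriv_compProd_right_eq_kernel_rnDeriv μ κ η h] with p hp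
        rw [hp]
      _ = ∫⁻ x, ∫⁻ y, ENNReal.ofReal (klFun (κ.rnDeriv η x y).toReal) ∂(η x) ∂μ :=
        Measure.lintegral_compProd hm
      _ = _ := by
        refine lintegral_congr_ae ?_
        filter_upwards [h] with x hx
        rw [klDiv_eq_lintegral_klFun_of_ac hx]
        refine lintegral_congr_ae ?_
        filter_upwards [Kernel.rnDeriv_eq_rnDeriv_measure (κ := κ) (η := η) (a := x)] with y hy
        rw [hy]
  · rw [klDiv_of_not_ac (mt Measure.absolutelyContinuous_compProd_right_iff.1 h), eq_comm,
      eq_top_iff]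
    have hs := (Kernel.measurableSet_absolutelyContinuous κ η).compl
    calc
      ∞ = ∞ * μ {x | κ x ≪ η x}ᶜ := (ENNReal.top_mul fun h0 ↦ h h0).symm
      _ = ∫⁻ x in {x | κ x ≪ η x}ᶜ, ∞ ∂μ := (setLIntegral_const _ _).symm
      _ = ∫⁻ x in {x | κ x ≪ η x}ᶜ, klDiv (κ x) (η x) ∂μ :=
        setLIntegral_congr_fun hs fun x hx ↦ (klDiv_of_not_ac hx).symm
      _ ≤ _ := setLIntegral_le_lintegral _ _

/-- Chain rule for KL divergence of joint distributions on a product of standard Borel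
spaces: `KL(P‖Q) = KL(P_X‖Q_X) + E_{x∼P_X}[KL(P_{Y|X=x}‖Q_{Y|X=x})]`, with marginals
`P_X, Q_X` and conditionals obtained by disintegration. -/
theorem kl_joint_eq_kl_marginal_add_expected_kl_cond
    {X Y : Type*} [MeasurableSpace X] [StandardBorelSpace X]
    [MeasurableSpace Y] [StandardBorelSpace Y] [Nonempty Y]
    (P Q : Measure (X × Y)) [IsProbabilityMeasure P] [IsProbabilityMeasure Q] :
    kl P Q = kl P.fst Q.fst + ∫⁻ x, kl (P.condKernel x) (Q.condKernel x) ∂P.fst := by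
  have hcond (x : X) : kl (P.condKernel x) (Q.condKernel x)
      = InformationTheory.klDiv (P.condKernel x) (Q.condKernel x) := kl_eq_klDiv _ _
  simp_rw [hcond, kl_eq_klDiv]
  conv_lhs => rw [← P.disintegrate P.condKernel, ← Q.disintegrate Q.condKernel]
  rw [InformationTheory.klDiv_compProd_eq_add, klDiv_compProd_right_eq_lintegral]
end
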